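/- arXiv:1105.3552 — 6 statements merged into one kernel-verified Lean document; each statement's English description precedes it below -/
import Mathlib

section
/- Extended contraction principle: Let (𝒳,d) and (𝒴,ρ) be metric spaces, let D_n ⊆ 𝒳 (n ≥ 1) be subsets, let f_n : D_n → 𝒴 be maps, and for each n let X_n be a map from a probability space (Ω_n, 𝓕_n, P_n) into D_n. Suppose (i) {X_n} satisfies the large deviation principle with speed λ(n) and inf-compact rate function I : 𝒳 → [0,∞], and (ii) there exists a map f : {I < ∞} → 𝒴 such that for every sequence x_n ∈ D_n with x_n → x ∈ {I < ∞} one has f_n(x_n) → f(x). Then {f_n(X_n)} satisfies the large deviation principle with speed λ(n) and rate function I_f(y) = inf{ I(x) : x ∈ {I<∞}, f(x) = y }. -/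
open MeasureTheory Filter Set
open scoped ENNReal Topology

/-- Outer probability `P^*(B) = inf { P(A) : A ⊇ B, A measurable }`. -/
noncomputable def outerP {Ω : Type*} [MeasurableSpace Ω] (P : Measure Ω) (B : Set Ω) : ℝ≥0∞ :=
  ⨅ (A : Set Ω) (_ : MeasurableSet A) (_ : B ⊆ A), P A

/-- Inner probability `P_*(B) = 1 - P^*(Bᶜ)`. -/
noncomputable def innerP {Ω : Type*} [MeasurableSpace Ω] (P : Measure Ω) (B : Set Ω) : ℝ≥0∞ :=
  1 - outerP P Bᶜ

/-- The sequence of maps `X n : Ω n → 𝒳` satisfies the large deviation principle with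
speed `speed` and rate function `I`: the lower bound with inner probabilities over open sets
and the upper bound with outer probabilities over closed sets. -/
def IsLDP {𝒳 : Type*} [TopologicalSpace 𝒳] {Ω : ℕ → Type*} [∀ n, MeasurableSpace (Ω n)]
    (P : ∀ n, Measure (Ω n)) (X : ∀ n, Ω n → 𝒳) (speed : ℕ → ℝ) (I : 𝒳 → ℝ≥0∞) : Prop :=
  (∀ G : Set 𝒳, IsOpen G →
      (-(⨅ x ∈ G, (I x : EReal))) ≤
        Filter.liminf
          (fun n => (((speed n)⁻¹ : ℝ) : EReal) * ENNReal.log (innerP (P n) (X n ⁻¹' G)))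
          Filter.atTop) ∧
  (∀ F : Set 𝒳, IsClosed F →
      Filter.limsup
          (fun n => (((speed n)⁻¹ : ℝ) : EReal) * ENNReal.log (outerP (P n) (X n ⁻¹' F)))
          Filter.atTop ≤
        -(⨅ x ∈ F, (I x : EReal)))

theorem outerP_eq_measure {Ω : Type*} [MeasurableSpace Ω] (P : Measure Ω) (B : Set Ω) :
    outerP P B = P B := by
  rw [measure_eq_iInf]
  unfold outerP
  congr 1
  funext A
  rw [iInf_comm]

theorem outerP_mono {Ω : Type*} [MeasurableSpace Ω] (P : Measure Ω) {A B : Set Ω} (h : A ⊆ B) :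
    outerP P A ≤ outerP P B := by
  simpa only [outerP_eq_measure] using measure_mono h

theorem innerP_mono {Ω : Type*} [MeasurableSpace Ω] (P : Measure Ω) {A B : Set Ω} (h : A ⊆ B) :
    innerP P A ≤ innerP P B :=
  tsub_le_tsub_left (outerP_mono P (compl_subset_compl.2 h)) 1

theorem innerP_empty {Ω : Type*} [MeasurableSpace Ω] (P : Measure Ω) [IsProbabilityMeasure P] :
    innerP P ∅ = 0 := by
  simp [innerP, outerP_eq_measure]

theorem inv_mul_log_mono {s : ℝ} (hs : 0 < s) {a b : ℝ≥0∞} (h : a ≤ b) :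
    ((s⁻¹ : ℝ) : EReal) * ENNReal.log a ≤ ((s⁻¹ : ℝ) : EReal) * ENNReal.log b :=
  mul_le_mul_of_nonneg_left (ENNReal.log_monotone h) (by exact_mod_cast (inv_pos.2 hs).le)

/-- Under an LDP, every neighbourhood of a point of finite rate is eventually visited. -/
theorem IsLDP.eventually_nonempty_preimage {𝒳 : Type*} [TopologicalSpace 𝒳] {Ω : ℕ → Type*}
    [∀ n, MeasurableSpace (Ω n)] {P : ∀ n, Measure (Ω n)} [∀ n, IsProbabilityMeasure (P n)]
    {X : ∀ n, Ω n → 𝒳} {speed : ℕ → ℝ} (hspeed : ∀ n, 0 < speed n) {I : 𝒳 → ℝ≥0∞}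
    (hLDP : IsLDP P X speed I) {x : 𝒳} (hx : I x < ⊤) {G : Set 𝒳} (hG : IsOpen G) (hxG : x ∈ G) :
    ∀ᶠ n in atTop, (X n ⁻¹' G).Nonempty := by
  have hlow : (⊥ : EReal) < -(⨅ x ∈ G, (I x : EReal)) := by
    rw [bot_lt_iff_ne_bot, Ne, EReal.neg_eq_bot_iff, ← Ne, ← lt_top_iff_ne_top]
    refine (iInf₂_le x hxG).trans_lt ?_
    rw [lt_top_iff_ne_top, Ne, EReal.coe_ennreal_eq_top_iff]
    exact hx.ne
  filter_upwards [eventually_lt_of_lt_liminf (hlow.trans_le (hLDP.1 G hG))] with n hn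
  by_contra hne
  rw [not_nonempty_iff_eq_empty.1 hne, innerP_empty, ENNReal.log_zero,
    EReal.coe_mul_bot_of_pos (inv_pos.2 (hspeed n))] at hn
  exact lt_irrefl _ hn

/-- If every ball around `x` eventually meets `D n`, some sequence `w n ∈ D n` tends to `x`. -/
theorem exists_seq_mem_tendsto {𝒳 : Type*} [PseudoMetricSpace 𝒳] {D : ℕ → Set 𝒳}
    (hne : ∀ n, (D n).Nonempty) {x : 𝒳}
    (h : ∀ ε > 0, ∀ᶠ n in atTop, (D n ∩ Metric.ball x ε).Nonempty) :
    ∃ w : ℕ → 𝒳, (∀ n, w n ∈ D n) ∧ Tendsto w atTop (𝓝 x) := by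
  have hpick : ∀ n : ℕ, ∃ z ∈ D n, dist z x < Metric.infDist x (D n) + 1 / ((n : ℝ) + 1) := by
    intro n
    obtain ⟨z, hz, hzx⟩ := (Metric.infDist_lt_iff (hne n)).1
      (lt_add_of_pos_right (Metric.infDist x (D n)) (Nat.one_div_pos_of_nat (n := n) (α := ℝ)))
    exact ⟨z, hz, by rwa [dist_comm]⟩
  choose w hwD hw using hpick
  refine ⟨w, hwD, Metric.tendsto_atTop'.2 fun ε hε => ?_⟩
  have hsmall := (tendsto_one_div_add_atTop_nhds_zero_nat (𝕜 := ℝ)).eventually_lt_const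
    (half_pos hε)
  obtain ⟨N, hN⟩ := eventually_atTop.1 ((h (ε / 2) (half_pos hε)).and hsmall)
  refine ⟨N, fun n hn => ?_⟩
  obtain ⟨⟨z, hzD, hz⟩, hn'⟩ := hN n hn.le
  have hinf := Metric.infDist_le_dist_of_mem (x := x) hzD
  rw [Metric.mem_ball, dist_comm] at hz
  linarith [hw n]

/-- Continuous convergence of `fn` along sequences in `D n` gives local uniform control. -/
theorem exists_ball_eventually_forall_mem {𝒳 𝒴 : Type*} [PseudoMetricSpace 𝒳] [TopologicalSpace 𝒴]
    {D : ℕ → Set 𝒳} {fn : ℕ → 𝒳 → 𝒴} {x : 𝒳} {y : 𝒴}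
    (hw : ∃ w : ℕ → 𝒳, (∀ n, w n ∈ D n) ∧ Tendsto w atTop (𝓝 x))
    (hf : ∀ xs : ℕ → 𝒳, (∀ n, xs n ∈ D n) →
      Tendsto xs atTop (𝓝 x) → Tendsto (fun n => fn n (xs n)) atTop (𝓝 y))
    {V : Set 𝒴} (hV : V ∈ 𝓝 y) :
    ∃ δ > 0, ∀ᶠ n in atTop, ∀ z ∈ D n, z ∈ Metric.ball x δ → fn n z ∈ V := by
  classical
  obtain ⟨w, hwD, hwx⟩ := hw
  by_contra! hcon
  have hfreq : ∀ k : ℕ, ∃ᶠ n in atTop,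
      ∃ z ∈ D n, z ∈ Metric.ball x (1 / ((k : ℝ) + 1)) ∧ fn n z ∉ V := fun k =>
    hcon _ Nat.one_div_pos_of_nat
  obtain ⟨φ, hφ, hbad⟩ := extraction_forall_of_frequently hfreq
  choose z hzD hzx hzV using hbad
  let xs : ℕ → 𝒳 := fun n => if h : ∃ k, φ k = n then z h.choose else w n
  have hxsφ : ∀ k, xs (φ k) = z k := by
    intro k
    have h : ∃ j, φ j = φ k := ⟨k, rfl⟩
    simp only [xs, dif_pos h, hφ.injective h.choose_spec]
  have hxsD : ∀ n, xs n ∈ D n := by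
    intro n
    by_cases h : ∃ k, φ k = n
    · obtain ⟨k, rfl⟩ := h
      rw [hxsφ]
      exact hzD k
    · simp only [xs, dif_neg h]
      exact hwD n
  have hxs : Tendsto xs atTop (𝓝 x) := by
    rw [Metric.tendsto_atTop']
    intro ε hε
    obtain ⟨N, hN⟩ := Metric.tendsto_atTop'.1 hwx ε hε
    obtain ⟨K, hK⟩ := eventually_atTop.1
      ((tendsto_one_div_add_atTop_nhds_zero_nat (𝕜 := ℝ)).eventually_lt_const hε)
    refine ⟨max N (φ K), fun n hn => ?_⟩
    by_cases h : ∃ k, φ k = n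
    · obtain ⟨k, rfl⟩ := h
      rw [hxsφ]
      have hKk : K < k := hφ.lt_iff_lt.1 ((le_max_right _ _).trans_lt hn)
      exact (hzx k).trans (hK k hKk.le)
    · simp only [xs, dif_neg h]
      exact hN n ((le_max_left _ _).trans_lt hn)
  obtain ⟨k, hk⟩ := (hφ.tendsto_atTop.eventually ((hf xs hxsD hxs).eventually hV)).exists
  rw [hxsφ] at hk
  exact hzV k hk

theorem EReal.le_coe_ennreal_iff_toENNReal_le {a : EReal} {b : ℝ≥0∞} :
    a ≤ (b : EReal) ↔ a.toENNReal ≤ b := by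
  rw [← EReal.coe_ennreal_le_coe_ennreal_iff, EReal.coe_toENNReal_eq_max]
  simp [EReal.coe_ennreal_nonneg]

theorem isCompact_setOf_coe_le {𝒳 : Type*} [TopologicalSpace 𝒳] {I : 𝒳 → ℝ≥0∞}
    (hI : ∀ L : ℝ, IsCompact {x | I x ≤ ENNReal.ofReal L}) (c : ℝ) :
    IsCompact {x | (I x : EReal) ≤ c} := by
  rcases lt_or_ge c 0 with hc | hc
  · convert isCompact_empty
    refine eq_empty_of_forall_notMem fun x hx => ?_
    exact absurd ((EReal.coe_ennreal_nonneg _).trans hx) (not_le.2 (by exact_mod_cast hc))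
  · convert hI c using 3 with x
    rw [← EReal.coe_ennreal_le_coe_ennreal_iff, EReal.coe_ennreal_ofReal, max_eq_left hc]

/-- **Extended contraction principle.** -/
theorem extended_contraction_principle
    {𝒳 𝒴 : Type*} [MetricSpace 𝒳] [MetricSpace 𝒴]
    {Ω : ℕ → Type*} [∀ n, MeasurableSpace (Ω n)]
    (P : ∀ n, Measure (Ω n)) [∀ n, IsProbabilityMeasure (P n)]
    (D : ℕ → Set 𝒳) (X : ∀ n, Ω n → 𝒳) (hXD : ∀ n ω, X n ω ∈ D n)
    (speed : ℕ → ℝ) (hspeed_pos : ∀ n, 0 < speed n) (hspeed : Tendsto speed atTop atTop)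
    (I : 𝒳 → ℝ≥0∞) (hIcompact : ∀ L : ℝ, IsCompact {x | I x ≤ ENNReal.ofReal L})
    (hLDP : IsLDP P X speed I)
    (fn : ℕ → 𝒳 → 𝒴) (f : 𝒳 → 𝒴)
    (hf : ∀ x : 𝒳, I x < ⊤ → ∀ xs : ℕ → 𝒳, (∀ n, xs n ∈ D n) →
      Tendsto xs atTop (𝓝 x) → Tendsto (fun n => fn n (xs n)) atTop (𝓝 (f x))) :
    IsLDP P (fun n ω => fn n (X n ω)) speed
      (fun y => ⨅ (x : 𝒳) (_ : I x < ⊤) (_ : f x = y), I x) := by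
  have hD : ∀ n, (D n).Nonempty := fun n =>
    have := (P n).nonempty_of_neZero
    ⟨X n (Classical.arbitrary _), hXD n _⟩
  have hlocal : ∀ x, I x < ⊤ → ∀ V ∈ 𝓝 (f x), ∃ δ > 0,
      ∀ᶠ n in atTop, ∀ z ∈ D n, z ∈ Metric.ball x δ → fn n z ∈ V := by
    intro x hx V hV
    refine exists_ball_eventually_forall_mem (exists_seq_mem_tendsto hD fun ε hε => ?_)
      (hf x hx) hV
    filter_upwards [hLDP.eventually_nonempty_preimage hspeed_pos hx Metric.isOpen_ball
      (Metric.mem_ball_self hε)] with n ⟨ω, hω⟩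
    exact ⟨X n ω, hXD n ω, hω⟩
  refine ⟨fun G hG => ?_, fun F hF => ?_⟩
  · rw [EReal.neg_le]
    refine le_iInf₂ fun y hy => ?_
    rw [EReal.le_coe_ennreal_iff_toENNReal_le]
    refine le_iInf fun x => le_iInf₂ fun hx hxy => ?_
    rw [← EReal.le_coe_ennreal_iff_toENNReal_le, EReal.neg_le]
    obtain ⟨δ, hδ, hev⟩ := hlocal x hx G (hG.mem_nhds (hxy ▸ hy))
    refine (EReal.neg_le_neg_iff.2 (iInf₂_le x (Metric.mem_ball_self hδ))).trans
      ((hLDP.1 _ Metric.isOpen_ball).trans (liminf_le_liminf ?_))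
    filter_upwards [hev] with n hn
    exact inv_mul_log_mono (hspeed_pos n) (innerP_mono _ fun ω hω => hn _ (hXD n ω) hω)
  · rw [EReal.le_neg]
    refine EReal.ge_of_forall_gt_iff_ge.1 fun c hc => ?_
    rw [EReal.le_neg]
    have hcover : ∀ x ∈ {x | (I x : EReal) ≤ c}, ∃ δ > 0,
        ∀ᶠ n in atTop, ∀ z ∈ D n, z ∈ Metric.ball x δ → fn n z ∈ Fᶜ := by
      intro x hxc
      have hx : I x < ⊤ := by
        rw [lt_top_iff_ne_top, Ne, ← EReal.coe_ennreal_eq_top_iff, ← Ne, ← lt_top_iff_ne_top]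
        exact lt_of_le_of_lt hxc (EReal.coe_lt_top c)
      refine hlocal x hx _ (hF.isOpen_compl.mem_nhds fun hxF => ?_)
      refine absurd hc (not_lt.2 ((iInf₂_le (f x) hxF).trans (le_trans ?_ hxc)))
      exact EReal.coe_ennreal_le_coe_ennreal_iff.2
        ((iInf_le _ x).trans ((iInf_le _ hx).trans (iInf_le _ rfl)))
    choose! δ hδ hev using hcover
    obtain ⟨t, htK, ht⟩ := (isCompact_setOf_coe_le hIcompact c).elim_nhds_subcover
      (fun x => Metric.ball x (δ x)) fun x hx => Metric.ball_mem_nhds x (hδ x hx)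
    have hU : IsOpen (⋃ x ∈ t, Metric.ball x (δ x)) :=
      isOpen_biUnion fun _ _ => Metric.isOpen_ball
    refine (limsup_le_limsup ?_).trans ((hLDP.2 _ hU.isClosed_compl).trans
      (EReal.neg_le_neg_iff.2 (le_iInf₂ fun x hx => ?_)))
    · filter_upwards [(Filter.eventually_all_finset t).2 fun x hx => hev x (htK x hx)] with n hn
      refine inv_mul_log_mono (hspeed_pos n) (outerP_mono _ fun ω hω hωU => ?_)
      obtain ⟨x, hxt, hxω⟩ := mem_iUnion₂.1 hωU
      exact hn x hxt _ (hXD n ω) hxω hω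
    · by_contra hlt
      exact hx (ht (not_le.1 hlt).le)
end

section
/- Let (𝒳,d) be a metric space, D_n ⊆ 𝒳 subsets, and X_n maps from probability spaces (Ω_n,𝓕_n,P_n) into D_n. Let I : 𝒳 → [0,∞]. If {X_n} satisfies the lower bound of large deviations with speed λ(n) and rate function I (i.e., for every open measurable G ⊆ 𝒳, liminf_n (1/λ(n)) log (P_n)_*(X_n ∈ G) ≥ −inf_{x∈G} I(x)), then {I < ∞} ⊆ D_∞, where D_∞ denotes the set of all x ∈ 𝒳 for which there exists a sequence x_n with x_n ∈ D_n for every n and x_n → x. -/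
open MeasureTheory Filter Set
open scoped ENNReal Topology

/-- A scaled logarithmic inner probability whose lower limit is not `⊥` eventually belongs to
nonempty events. -/
theorem eventually_nonempty_of_bot_lt_liminf {Ω : ℕ → Type*} [∀ n, MeasurableSpace (Ω n)]
    (P : ∀ n, Measure (Ω n)) [∀ n, IsProbabilityMeasure (P n)] (B : ∀ n, Set (Ω n))
    (c : ℕ → ℝ) (hc : ∀ n, 0 < c n)
    (h : ⊥ < liminf (fun n => (c n : EReal) * ENNReal.log (innerP (P n) (B n))) atTop) :
    ∀ᶠ n in atTop, (B n).Nonempty := by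
  filter_upwards [eventually_lt_of_lt_liminf h] with n hn
  rw [nonempty_iff_ne_empty]
  intro hB
  rw [hB, innerP_empty, ENNReal.log_zero, EReal.coe_mul_bot_of_pos (hc n)] at hn
  exact lt_irrefl _ hn

/-- If the lower bound of large deviations holds with speed `speed → ∞` and rate function `I`
for maps `X n` taking values in the sets `D n`, then every point of `{I < ∞}` is the limit of a
sequence `x n ∈ D n`. -/
theorem finiteRate_subset_Dinfty
    {𝒳 : Type*} [MetricSpace 𝒳]
    {Ω : ℕ → Type*} [∀ n, MeasurableSpace (Ω n)]
    (P : ∀ n, Measure (Ω n)) [∀ n, IsProbabilityMeasure (P n)]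
    (D : ℕ → Set 𝒳) (X : ∀ n, Ω n → 𝒳) (hXD : ∀ n ω, X n ω ∈ D n)
    (speed : ℕ → ℝ) (hspeed_pos : ∀ n, 0 < speed n) (hspeed : Tendsto speed atTop atTop)
    (I : 𝒳 → ℝ≥0∞)
    (hLLD : ∀ G : Set 𝒳, IsOpen G →
      (-(⨅ x ∈ G, (I x : EReal))) ≤
        Filter.liminf
          (fun n => (((speed n)⁻¹ : ℝ) : EReal) * ENNReal.log (innerP (P n) (X n ⁻¹' G)))
          Filter.atTop) :
    {x | I x < ⊤} ⊆
      {x | ∃ xs : ℕ → 𝒳, (∀ n, xs n ∈ D n) ∧ Tendsto xs atTop (𝓝 x)} := by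
  intro x hx
  have hne : ∀ n, (D n).Nonempty := fun n =>
    have := nonempty_of_isProbabilityMeasure (P n)
    ⟨_, hXD n (Classical.arbitrary (Ω n))⟩
  have hdist : Tendsto (fun n => Metric.infDist x (D n)) atTop (𝓝 0) := by
    rw [tendsto_order]
    refine ⟨fun a ha => .of_forall fun n => ha.trans_le Metric.infDist_nonneg, fun r hr => ?_⟩
    have hbot : ⊥ < -(⨅ y ∈ Metric.ball x r, (I y : EReal)) := by
      have hle : (⨅ y ∈ Metric.ball x r, (I y : EReal)) ≤ I x :=
        iInf₂_le x (Metric.mem_ball_self hr)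
      rw [bot_lt_iff_ne_bot, Ne, EReal.neg_eq_bot_iff, ← Ne, ← lt_top_iff_ne_top]
      exact hle.trans_lt (by simpa [lt_top_iff_ne_top] using hx)
    filter_upwards [eventually_nonempty_of_bot_lt_liminf P _ _
      (fun n => inv_pos.2 (hspeed_pos n))
      (hbot.trans_le (hLLD _ Metric.isOpen_ball))] with n ⟨ω, hω⟩
    exact (Metric.infDist_lt_iff (hne n)).2 ⟨X n ω, hXD n ω, Metric.mem_ball'.1 hω⟩
  have hnear : ∀ n : ℕ, ∃ y ∈ D n, dist x y < Metric.infDist x (D n) + 1 / ((n : ℝ) + 1) :=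
    fun n => (Metric.infDist_lt_iff (hne n)).1 (lt_add_of_pos_right _ Nat.one_div_pos_of_nat)
  choose xs hxs hlt using hnear
  refine ⟨xs, hxs, tendsto_iff_dist_tendsto_zero.2 ?_⟩
  refine squeeze_zero (fun _ => dist_nonneg) (fun n => ?_)
    (by simpa only [add_zero] using hdist.add (tendsto_one_div_add_atTop_nhds_zero_nat (𝕜 := ℝ)))
  rw [dist_comm]
  exact (hlt n).le
end

section
/- Let (𝒳,d) and (𝒴,ρ) be metric spaces, D_n ⊆ 𝒳 subsets, f_n : D_n → 𝒴 maps, and I : 𝒳 → [0,∞]. Suppose {I < ∞} ⊆ D_∞ (where D_∞ is the set of x for which there exists x_n ∈ D_n with x_n → x), and suppose there is a map f : {I < ∞} → 𝒴 such that for every (full) sequence x_n ∈ D_n with x_n → x ∈ {I < ∞} one has f_n(x_n) → f(x). Then: (a) for every subsequence x_{n_k} ∈ D_{n_k} with x_{n_k} → x ∈ {I < ∞}, one has f_{n_k}(x_{n_k}) → f(x); and (b) the restriction of f to {I < ∞} is continuous. -/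
open Filter Set
open scoped ENNReal Topology

/-- If `xs k → x` is indexed along a strictly increasing `φ`, then filling the remaining indices
with the values of a sequence converging to `x` yields a sequence converging to `x`. -/
theorem StrictMono.tendsto_extend_atTop {α : Type*} {l : Filter α} {φ : ℕ → ℕ}
    (hφ : StrictMono φ) {xs ys : ℕ → α} (hxs : Tendsto xs atTop l) (hys : Tendsto ys atTop l) :
    Tendsto (Function.extend φ xs ys) atTop l := by
  intro U hU
  obtain ⟨K, hK⟩ := eventually_atTop.1 (hxs hU)
  obtain ⟨N, hN⟩ := eventually_atTop.1 (hys hU)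
  refine eventually_atTop.2 ⟨max (φ K) N, fun n hn => ?_⟩
  by_cases h : ∃ k, φ k = n
  · obtain ⟨k, rfl⟩ := h
    rw [hφ.injective.extend_apply]
    exact hK k (hφ.le_iff_le.1 ((le_max_left _ _).trans hn))
  · rw [Function.extend_apply' _ _ _ h]
    exact hN n ((le_max_right _ _).trans hn)

/-- Convergence along all subsequences gives a uniform estimate on a ball for all large
indices. -/
theorem exists_ball_eventually_dist_lt_of_subseq_tendsto {𝒳 𝒴 : Type*}
    [PseudoMetricSpace 𝒳] [PseudoMetricSpace 𝒴] {D : ℕ → Set 𝒳} {fn : ℕ → 𝒳 → 𝒴}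
    {x : 𝒳} {y : 𝒴}
    (h : ∀ φ : ℕ → ℕ, StrictMono φ → ∀ xs : ℕ → 𝒳, (∀ k, xs k ∈ D (φ k)) →
      Tendsto xs atTop (𝓝 x) → Tendsto (fun k => fn (φ k) (xs k)) atTop (𝓝 y))
    {ε : ℝ} (hε : 0 < ε) :
    ∃ δ > 0, ∀ᶠ n in atTop, ∀ z ∈ D n, dist z x < δ → dist (fn n z) y < ε := by
  by_contra! hbad
  have hfreq : ∀ k : ℕ, ∃ᶠ n in atTop,
      ∃ z ∈ D n, dist z x < 1 / ((k : ℝ) + 1) ∧ ε ≤ dist (fn n z) y := by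
    intro k
    simpa using hbad (1 / ((k : ℝ) + 1)) Nat.one_div_pos_of_nat
  obtain ⟨φ, hφ, hz⟩ := extraction_forall_of_frequently hfreq
  choose zs hzD hzx hzy using hz
  have hlim : Tendsto zs atTop (𝓝 x) :=
    tendsto_iff_dist_tendsto_zero.2 <|
      squeeze_zero (fun _ => dist_nonneg) (fun k => (hzx k).le)
        tendsto_one_div_add_atTop_nhds_zero_nat
  obtain ⟨k, hk⟩ := (Metric.tendsto_nhds.1 (h φ hφ zs hzD hlim) ε hε).exists
  exact (hzy k).not_gt hk

/-- If every point of `{I < ∞}` is a limit of points `x n ∈ D n`, and `f n (x n) → f x`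
for every full sequence `x n ∈ D n` converging to a point `x` with `I x < ∞`, then the same
convergence holds along subsequences, and the restriction of `f` to `{I < ∞}` is continuous. -/
theorem subsequence_convergence_and_continuity
    {𝒳 𝒴 : Type*} [MetricSpace 𝒳] [MetricSpace 𝒴]
    (D : ℕ → Set 𝒳) (fn : ℕ → 𝒳 → 𝒴) (I : 𝒳 → ℝ≥0∞) (f : 𝒳 → 𝒴)
    (hDinf : ∀ x : 𝒳, I x < ⊤ → ∃ xs : ℕ → 𝒳, (∀ n, xs n ∈ D n) ∧ Tendsto xs atTop (𝓝 x))
    (hf : ∀ x : 𝒳, I x < ⊤ → ∀ xs : ℕ → 𝒳, (∀ n, xs n ∈ D n) →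
      Tendsto xs atTop (𝓝 x) → Tendsto (fun n => fn n (xs n)) atTop (𝓝 (f x))) :
    (∀ (φ : ℕ → ℕ), StrictMono φ → ∀ (xs : ℕ → 𝒳) (x : 𝒳), I x < ⊤ →
        (∀ k, xs k ∈ D (φ k)) → Tendsto xs atTop (𝓝 x) →
        Tendsto (fun k => fn (φ k) (xs k)) atTop (𝓝 (f x))) ∧
      ContinuousOn f {x | I x < ⊤} := by
  have hsub : ∀ (φ : ℕ → ℕ), StrictMono φ → ∀ (xs : ℕ → 𝒳) (x : 𝒳), I x < ⊤ →
      (∀ k, xs k ∈ D (φ k)) → Tendsto xs atTop (𝓝 x) →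
      Tendsto (fun k => fn (φ k) (xs k)) atTop (𝓝 (f x)) := by
    intro φ hφ xs x hx hxs hlim
    obtain ⟨ys, hys, hylim⟩ := hDinf x hx
    have hmem : ∀ n, Function.extend φ xs ys n ∈ D n := by
      intro n
      by_cases h : ∃ k, φ k = n
      · obtain ⟨k, rfl⟩ := h
        rw [hφ.injective.extend_apply]
        exact hxs k
      · rw [Function.extend_apply' _ _ _ h]
        exact hys n
    have := (hf x hx _ hmem (hφ.tendsto_extend_atTop hlim hylim)).comp hφ.tendsto_atTop
    simpa only [Function.comp_def, hφ.injective.extend_apply] using this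
  refine ⟨hsub, Metric.continuousOn_iff.2 fun x hx ε hε => ?_⟩
  obtain ⟨δ, hδ, hev⟩ := exists_ball_eventually_dist_lt_of_subseq_tendsto
    (fun φ hφ xs => hsub φ hφ xs x hx) (half_pos hε)
  refine ⟨δ, hδ, fun x' hx' hdist => ?_⟩
  obtain ⟨ys, hys, hylim⟩ := hDinf x' hx'
  have hle : dist (f x') (f x) ≤ ε / 2 := by
    refine le_of_tendsto ((hf x' hx' ys hys hylim).dist tendsto_const_nhds) ?_
    filter_upwards [hev, hylim (Metric.isOpen_ball.mem_nhds hdist)] with n hn hball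
    exact (hn (ys n) (hys n) hball).le
  linarith
end

section
/- Let (𝒳,d) and (𝒴,ρ) be metric spaces, let I : 𝒳 → [0,∞] be inf-compact (i.e., {I ≤ L} is compact for every L ∈ ℝ), and let f : {I < ∞} → 𝒴 be continuous on {I < ∞}. Define I_f(y) = inf{ I(x) : x ∈ {I<∞}, f(x) = y } for y ∈ 𝒴. Then for every L ≥ 0 one has {y : I_f(y) ≤ L} = f({x : I(x) ≤ L}), and consequently I_f is inf-compact: {I_f ≤ L} is compact for every L ∈ [0,∞). -/
open Filter Set
open scoped ENNReal Topology

/-- Over each point, a function with compact sublevel sets attains the constrained infimum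
along the fibre of a map continuous on its effective domain. -/
theorem exists_le_of_iInf_fiber_le
    {X Y : Type*} [TopologicalSpace X] [T2Space X] [TopologicalSpace Y] [T1Space Y]
    {I : X → ℝ≥0∞} (hI : ∀ L : ℝ, IsCompact {x | I x ≤ ENNReal.ofReal L})
    {f : X → Y} (hf : ContinuousOn f {x | I x < ⊤}) {L : ℝ} {y : Y} (hL : 0 ≤ L)
    (hy : (⨅ (x : X) (_ : I x < ⊤) (_ : f x = y), I x) ≤ ENNReal.ofReal L) :
    ∃ x, I x ≤ ENNReal.ofReal L ∧ f x = y := by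
  let C : ℕ → Set X := fun n =>
    {x | I x ≤ ENNReal.ofReal (L + 1 / ((n : ℝ) + 1))} ∩ f ⁻¹' {y}
  have hclosed (n : ℕ) : IsClosed (C n) :=
    (hf.mono fun x hx => lt_of_le_of_lt hx ENNReal.ofReal_lt_top).preimage_isClosed_of_isClosed
      (hI _).isClosed isClosed_singleton
  have hanti (n : ℕ) : C (n + 1) ⊆ C n := by
    rintro x ⟨hx, hxy⟩
    refine ⟨le_trans hx (ENNReal.ofReal_le_ofReal ?_), hxy⟩
    have := Nat.one_div_le_one_div (α := ℝ) n.le_succ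
    push_cast at this ⊢
    linarith
  have hne (n : ℕ) : (C n).Nonempty := by
    have hlt : ENNReal.ofReal L < ENNReal.ofReal (L + 1 / ((n : ℝ) + 1)) := by
      have := Nat.one_div_pos_of_nat (α := ℝ) (n := n)
      exact (ENNReal.ofReal_lt_ofReal_iff (by linarith)).2 (by linarith)
    have hlt' := hy.trans_lt hlt
    simp only [iInf_lt_iff] at hlt'
    obtain ⟨x, -, hxy, hx⟩ := hlt'
    exact ⟨x, hx.le, hxy⟩
  have hcompact : IsCompact (C 0) := (hI _).of_isClosed_subset (hclosed 0) inter_subset_left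
  obtain ⟨x, hx⟩ := IsCompact.nonempty_iInter_of_sequence_nonempty_isCompact_isClosed
    C hanti hne hcompact hclosed
  rw [mem_iInter] at hx
  refine ⟨x, ?_, (hx 0).2⟩
  have hlim : Tendsto (fun n : ℕ => ENNReal.ofReal (L + 1 / ((n : ℝ) + 1))) atTop
      (𝓝 (ENNReal.ofReal L)) := by
    simpa using ENNReal.tendsto_ofReal
      ((tendsto_one_div_add_atTop_nhds_zero_nat (𝕜 := ℝ)).const_add L)
  exact ge_of_tendsto' hlim fun n => (hx n).1

/-- For an inf-compact rate function `I` and a map `f` continuous on `{I < ∞}`, the sublevel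
sets of the induced rate function `I_f (y) = inf { I x : I x < ∞, f x = y }` satisfy
`{I_f ≤ L} = f '' {I ≤ L}` for every `L ≥ 0`; consequently `I_f` is inf-compact. -/
theorem inducedRate_sublevel_eq_image_and_infCompact
    {𝒳 𝒴 : Type*} [MetricSpace 𝒳] [MetricSpace 𝒴]
    (I : 𝒳 → ℝ≥0∞) (hIcompact : ∀ L : ℝ, IsCompact {x | I x ≤ ENNReal.ofReal L})
    (f : 𝒳 → 𝒴) (hf : ContinuousOn f {x | I x < ⊤}) :
    ∀ L : ℝ, 0 ≤ L →
      ({y | (⨅ (x : 𝒳) (_ : I x < ⊤) (_ : f x = y), I x) ≤ ENNReal.ofReal L} =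
          f '' {x | I x ≤ ENNReal.ofReal L}) ∧
        IsCompact {y | (⨅ (x : 𝒳) (_ : I x < ⊤) (_ : f x = y), I x) ≤ ENNReal.ofReal L} := by
  intro L hL
  have heq : {y | (⨅ (x : 𝒳) (_ : I x < ⊤) (_ : f x = y), I x) ≤ ENNReal.ofReal L} =
      f '' {x | I x ≤ ENNReal.ofReal L} := by
    ext y
    constructor
    · exact exists_le_of_iInf_fiber_le hIcompact hf hL
    · rintro ⟨x, hx, rfl⟩
      rw [mem_ofPred_eq]
      exact iInf_le_of_le x (iInf_le_of_le (lt_of_le_of_lt hx ENNReal.ofReal_lt_top)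
        (iInf_le_of_le rfl hx))
  refine ⟨heq, ?_⟩
  rw [heq]
  exact (hIcompact L).image_of_continuousOn
    (hf.mono fun x hx => lt_of_le_of_lt hx ENNReal.ofReal_lt_top)
end

section
/- Let Y be a random variable with values in a Banach space and let a(n) be a sequence of positive reals with a(n) → ∞ and a(n)/√n → 0. If there exists a sequence of increasing nonnegative functions H_k, k ≥ 1, on (0,∞) such that lim_{u→∞} u^{−2} H_k(u) = +∞ for each k, lim_{k→∞} lim_{n→∞} (1/a(n)²) log( H_k(√n·a(n)) / n ) = +∞, and E[H_k(‖Y‖)] < ∞ for every k ≥ 1, then limsup_{n→∞} (1/a(n)²) log( n · P(‖Y‖ ≥ √n·a(n)) ) = −∞. -/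
open MeasureTheory Filter Set
open scoped ENNReal Topology

/-- Tail negligibility at moderate deviation scale for a Banach-space valued random variable,
under a family of moment conditions. -/
theorem banach_tail_negligible
    {Ω : Type*} [MeasurableSpace Ω] (P : Measure Ω) [IsProbabilityMeasure P]
    {B : Type*} [NormedAddCommGroup B] [NormedSpace ℝ B] [CompleteSpace B]
    [MeasurableSpace B] [BorelSpace B]
    (Y : Ω → B) (hY : Measurable Y)
    (a : ℕ → ℝ) (ha_pos : ∀ n, 0 < a n) (ha_top : Tendsto a atTop atTop)
    (ha_sqrt : Tendsto (fun n => a n / Real.sqrt n) atTop (𝓝 0))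
    (H : ℕ → ℝ → ℝ)
    (hH_mono : ∀ k, MonotoneOn (H k) (Set.Ioi (0 : ℝ)))
    (hH_nonneg : ∀ k, ∀ u : ℝ, 0 < u → 0 ≤ H k u)
    (hH_growth : ∀ k, Tendsto (fun u : ℝ => H k u / u ^ 2) atTop atTop)
    (hH_speed : ∀ M : ℝ, ∀ᶠ k in atTop, ∀ᶠ n in atTop,
      M ≤ ((a n) ^ 2)⁻¹ * Real.log (H k (Real.sqrt n * a n) / n))
    (hH_int : ∀ k, Integrable (fun ω => H k ‖Y ω‖) P) :
    Filter.limsup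
        (fun n => ((((a n) ^ 2)⁻¹ : ℝ) : EReal) *
          ENNReal.log ((n : ℝ≥0∞) * P {ω | Real.sqrt n * a n ≤ ‖Y ω‖}))
        Filter.atTop = (⊥ : EReal) := by
  have key : ∀ M : ℝ, 1 ≤ M → ∀ᶠ n in atTop,
      ((((a n) ^ 2)⁻¹ : ℝ) : EReal) *
          ENNReal.log ((n : ℝ≥0∞) * P {ω | Real.sqrt n * a n ≤ ‖Y ω‖}) ≤
        ((1 - M : ℝ) : EReal) := by
    intro M hM
    obtain ⟨k, hk⟩ := (hH_speed M).exists
    set C : ℝ := (∫ ω, |H k ‖Y ω‖| ∂P) + 1 with hC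
    have hCpos : 0 < C := by
      have : 0 ≤ ∫ ω, |H k ‖Y ω‖| ∂P := integral_nonneg fun ω => abs_nonneg _
      linarith
    have ha_sq : Tendsto (fun n => (a n) ^ 2) atTop atTop :=
      (tendsto_pow_atTop two_ne_zero).comp ha_top
    filter_upwards [hk, eventually_ge_atTop 1, ha_sq.eventually_ge_atTop (Real.log C)]
      with n hn hn1 hlog
    have hn0 : (0 : ℝ) < n := by exact_mod_cast hn1
    have ha2 : 0 < (a n) ^ 2 := pow_pos (ha_pos n) 2
    have hx : 0 < Real.sqrt n * a n := mul_pos (Real.sqrt_pos.2 hn0) (ha_pos n)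
    set x := Real.sqrt n * a n with hxdef
    have hn' : M * (a n) ^ 2 ≤ Real.log (H k x / n) := by
      rwa [inv_mul_eq_div, le_div_iff₀ ha2] at hn
    have hq0 : 0 < H k x / n := by
      refine (div_nonneg (hH_nonneg k x hx) hn0.le).lt_of_ne ?_
      intro h
      rw [← h, Real.log_zero] at hn'
      nlinarith
    have hHx : 0 < H k x := (div_pos_iff_of_pos_right hn0).1 hq0
    have hexp : Real.exp (M * (a n) ^ 2) * n ≤ H k x := by
      rw [← le_div_iff₀ hn0]
      exact (Real.le_log_iff_exp_le hq0).1 hn'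
    have hmarkov : H k x * P.real {ω | x ≤ ‖Y ω‖} ≤ C := by
      have h1 := mul_meas_ge_le_integral_of_nonneg (μ := P)
        (Eventually.of_forall fun ω => abs_nonneg (H k ‖Y ω‖)) (hH_int k).abs (H k x)
      have h2 : P.real {ω | x ≤ ‖Y ω‖} ≤ P.real {ω | H k x ≤ |H k ‖Y ω‖|} :=
        measureReal_mono fun ω (hω : x ≤ ‖Y ω‖) =>
          (hH_mono k hx (hx.trans_le hω) hω).trans (le_abs_self _)
      have h3 := mul_le_mul_of_nonneg_left h2 hHx.le
      linarith
    have hreal : n * P.real {ω | x ≤ ‖Y ω‖} ≤ C * Real.exp (-(M * (a n) ^ 2)) := by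
      rw [Real.exp_neg, ← div_eq_mul_inv, le_div_iff₀ (Real.exp_pos _)]
      have := mul_le_mul_of_nonneg_right hexp
        (measureReal_nonneg (μ := P) (s := {ω | x ≤ ‖Y ω‖}))
      linarith
    have hbound : (n : ℝ≥0∞) * P {ω | x ≤ ‖Y ω‖} ≤
        ENNReal.ofReal (C * Real.exp (-(M * (a n) ^ 2))) := by
      have h := ENNReal.ofReal_le_ofReal hreal
      rwa [ENNReal.ofReal_mul hn0.le, ENNReal.ofReal_natCast, ofReal_measureReal] at h
    have hpos : 0 < C * Real.exp (-(M * (a n) ^ 2)) := mul_pos hCpos (Real.exp_pos _)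
    calc _ ≤ ((((a n) ^ 2)⁻¹ : ℝ) : EReal) *
          ENNReal.log (ENNReal.ofReal (C * Real.exp (-(M * (a n) ^ 2)))) :=
          mul_le_mul_of_nonneg_left (ENNReal.log_monotone hbound)
            (EReal.coe_nonneg.2 (inv_nonneg.2 ha2.le))
      _ = ((((a n) ^ 2)⁻¹ * (Real.log C - M * (a n) ^ 2) : ℝ) : EReal) := by
          rw [ENNReal.log_ofReal_of_pos hpos, ← EReal.coe_mul,
            Real.log_mul hCpos.ne' (Real.exp_pos _).ne', Real.log_exp, sub_eq_add_neg]
      _ ≤ _ := by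
          rw [EReal.coe_le_coe_iff, inv_mul_le_iff₀ ha2]
          linarith
  rw [EReal.eq_bot_iff_forall_lt]
  intro y
  refine (limsup_le_of_le (h := key (max 1 (2 - y)) (le_max_left _ _))).trans_lt ?_
  rw [EReal.coe_lt_coe_iff]
  linarith [le_max_right 1 (2 - y)]
end

section
/- Hadamard differentiability of the L-functional in L¹: Let D̃_Φ = { G̃(x) = G(x)·1_{(−∞,0)}(x) + (G(x) − 1)·1_{[0,∞)}(x) : G a distribution function on ℝ with ∫|x| dG(x) < ∞ } ⊆ L¹(ℝ), and D̃₀ = { a(G̃ − F̃) : a ∈ ℝ, G̃ ∈ D̃_Φ }. Define Φ̃ : D̃_Φ → ℝ by Φ̃(G̃) = ∫₀¹ G⁻¹(s) J(s) ds = ∫ x J(G(x)) dG(x). If J is Lipschitz continuous on [0,1], then Φ̃ is Hadamard differentiable at F̃ tangentially to D̃₀ with respect to L¹-convergence, with derivative Φ̃'_{F̃}(α) = − ∫_ℝ α(x) J(F(x)) dx for α ∈ D̃₀; that is, for any t_n → 0⁺ and H_n → α in L¹(ℝ) with α ∈ D̃₀ and F̃ + t_n H_n ∈ D̃_Φ for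 every n, (Φ̃(F̃ + t_n H_n) − Φ̃(F̃))/t_n → − ∫ α(x) J(F(x)) dx. -/
open MeasureTheory Filter Set
open scoped ENNReal Topology

/-- The generalized inverse `G⁻¹(s) = inf {x : G(x) ≥ s}` of a nondecreasing function. -/
noncomputable def genInv (G : ℝ → ℝ) (s : ℝ) : ℝ := sInf {x | s ≤ G x}

/-- A distribution function on `ℝ`: nondecreasing, right-continuous, with limits `0` at `-∞`
and `1` at `+∞`. -/
def IsDistF (G : ℝ → ℝ) : Prop :=
  Monotone G ∧ Tendsto G atBot (𝓝 0) ∧ Tendsto G atTop (𝓝 1) ∧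
    ∀ x, ContinuousWithinAt G (Set.Ici x) x

/-- The shifted version `G̃(x) = G(x)·1_{(-∞,0)}(x) + (G(x)-1)·1_{[0,∞)}(x)` of a distribution
function `G`, which belongs to `L¹(ℝ)` exactly when `∫|x| dG(x) < ∞`. -/
noncomputable def tilt (G : ℝ → ℝ) (x : ℝ) : ℝ := if x < 0 then G x else G x - 1

/-- Recover the distribution function from its shifted version. -/
noncomputable def untilt (h : ℝ → ℝ) (x : ℝ) : ℝ := if x < 0 then h x else h x + 1

/-- The L-functional `Φ̃(G̃) = ∫₀¹ G⁻¹(s) J(s) ds`, defined on shifted distribution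
functions. -/
noncomputable def LFun (J : ℝ → ℝ) (h : ℝ → ℝ) : ℝ :=
  ∫ s in Set.Ioo (0:ℝ) 1, genInv (untilt h) s * J s

/-- The Galois connection between a distribution function and its generalized inverse. -/
theorem IsDistF.genInv_le_iff {G : ℝ → ℝ} (hG : IsDistF G) {s : ℝ} (hs : s ∈ Ioo (0 : ℝ) 1)
    (x : ℝ) : genInv G s ≤ x ↔ s ≤ G x := by
  obtain ⟨hmono, hbot, htop, hright⟩ := hG
  obtain ⟨b, hb⟩ := (hbot.eventually_lt_const hs.1).exists
  obtain ⟨c, hc⟩ := (htop.eventually_const_lt hs.2).exists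
  have hbdd : BddBelow {x | s ≤ G x} := by
    refine ⟨b, fun y hy => ?_⟩
    by_contra! h
    exact absurd (hmono h.le) (not_le.2 (hb.trans_le hy))
  have hne : {x | s ≤ G x}.Nonempty := ⟨c, hc.le⟩
  refine ⟨fun h => ?_, fun h => csInf_le hbdd h⟩
  refine le_trans ?_ (hmono h)
  have hr : Tendsto G (𝓝[>] (genInv G s)) (𝓝 (G (genInv G s))) :=
    (hright _).mono_left (nhdsWithin_mono _ Ioi_subset_Ici_self)
  refine ge_of_tendsto hr ?_
  filter_upwards [self_mem_nhdsWithin] with y hy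
  obtain ⟨z, hz, hzy⟩ := exists_lt_of_csInf_lt hne hy
  exact le_trans hz (hmono hzy.le)

theorem IsDistF.mem_Icc {G : ℝ → ℝ} (hG : IsDistF G) (x : ℝ) : G x ∈ Icc (0 : ℝ) 1 :=
  ⟨hG.1.le_of_tendsto hG.2.1 x, hG.1.ge_of_tendsto hG.2.2.1 x⟩

theorem untilt_tilt (G : ℝ → ℝ) : untilt (tilt G) = G := by
  ext x
  by_cases hx : x < 0 <;> simp [untilt, tilt, hx]

/-- The difference `1_{[0,∞)}(x) - 1_{(-∞,g]}(s)`, whose integral in `x` along `g = G x` is the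
quantile `G⁻¹(s)`, and whose integral in `s` is minus the shifted distribution function. -/
noncomputable def signedGap (g s x : ℝ) : ℝ :=
  (Ici (0 : ℝ)).indicator 1 x - (Iic g).indicator 1 s

theorem integral_indicator_Ici_sub (y : ℝ) :
    ∫ x : ℝ, ((Ici (0 : ℝ)).indicator 1 x - (Ici y).indicator 1 x : ℝ) = y := by
  rcases le_total 0 y with hy | hy
  · have h : (fun x : ℝ => ((Ici (0 : ℝ)).indicator 1 x - (Ici y).indicator 1 x : ℝ)) =
        (Ico 0 y).indicator 1 := by
      ext x
      simp only [indicator_apply, mem_Ici, mem_Ico, Pi.one_apply]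
      grind
    rw [h, integral_indicator_one measurableSet_Ico]
    simp [hy]
  · have h : (fun x : ℝ => ((Ici (0 : ℝ)).indicator 1 x - (Ici y).indicator 1 x : ℝ)) =
        fun x => -((Ico y 0).indicator 1 x) := by
      ext x
      simp only [indicator_apply, mem_Ici, mem_Ico, Pi.one_apply]
      grind
    rw [h, integral_neg, integral_indicator_one measurableSet_Ico]
    simp [hy]

theorem IsDistF.integral_signedGap {G : ℝ → ℝ} (hG : IsDistF G) {s : ℝ}
    (hs : s ∈ Ioo (0 : ℝ) 1) : ∫ x, signedGap (G x) s x = genInv G s := by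
  rw [← integral_indicator_Ici_sub (genInv G s)]
  congr 1 with x
  simp [signedGap, indicator_apply, hG.genInv_le_iff hs]

theorem setIntegral_mul_signedGap (φ : ℝ → ℝ) {g : ℝ}
    (hg : g ∈ Icc (0 : ℝ) 1) (x : ℝ) :
    ∫ s in Ioo (0 : ℝ) 1, φ s * signedGap g s x =
      if x < 0 then -∫ s in (0 : ℝ)..g, φ s else ∫ s in g..1, φ s := by
  rw [← integral_Ioc_eq_integral_Ioo]
  split_ifs with hx
  · have h : (fun s => φ s * signedGap g s x) = fun s => -((Iic g).indicator φ s) := by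
      ext s
      simp only [signedGap, indicator_apply, mem_Ici, mem_Iic, Pi.one_apply]
      grind
    rw [h, integral_neg, setIntegral_indicator measurableSet_Iic, Ioc_inter_Iic,
      min_eq_right hg.2, intervalIntegral.integral_of_le hg.1]
  · have h : (fun s => φ s * signedGap g s x) = (Ioi g).indicator φ := by
      ext s
      simp only [signedGap, indicator_apply, mem_Ici, mem_Iic, mem_Ioi, Pi.one_apply]
      grind
    rw [h, setIntegral_indicator measurableSet_Ioi, Ioc_inter_Ioi,
      max_eq_right hg.1, intervalIntegral.integral_of_le hg.2]

theorem setIntegral_abs_signedGap {g : ℝ} (hg : g ∈ Icc (0 : ℝ) 1) (x : ℝ) :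
    ∫ s in Ioo (0 : ℝ) 1, |signedGap g s x| = if x < 0 then g else 1 - g := by
  have key := setIntegral_mul_signedGap (fun _ => 1) hg x
  simp only [one_mul, intervalIntegral.integral_const, smul_eq_mul, mul_one, sub_zero] at key
  split_ifs with hx
  · have h : (fun s => |signedGap g s x|) = fun s => -signedGap g s x := by
      ext s
      simp only [signedGap, indicator_apply, mem_Ici, mem_Iic, Pi.one_apply]
      grind
    rw [h, integral_neg, key, if_pos hx, neg_neg]
  · have h : (fun s => |signedGap g s x|) = fun s => signedGap g s x := by
      ext s
      simp only [signedGap, indicator_apply, mem_Ici, mem_Iic, Pi.one_apply]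
      grind
    rw [h, key, if_neg hx]

theorem measurable_signedGap {G : ℝ → ℝ} (hG : Measurable G) :
    Measurable fun p : ℝ × ℝ => signedGap (G p.2) p.1 p.2 := by
  have h : (fun p : ℝ × ℝ => signedGap (G p.2) p.1 p.2) = fun p =>
      (if 0 ≤ p.2 then 1 else 0) - if p.1 ≤ G p.2 then 1 else 0 := by
    ext p
    simp [signedGap, indicator_apply]
  rw [h]
  exact (Measurable.ite (measurableSet_le measurable_const measurable_snd)
      measurable_const measurable_const).sub
    (Measurable.ite (measurableSet_le measurable_fst (hG.comp measurable_snd))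
      measurable_const measurable_const)

theorem abs_signedGap_le_one (g s x : ℝ) : |signedGap g s x| ≤ 1 := by
  simp only [signedGap, indicator_apply, mem_Ici, mem_Iic, Pi.one_apply]
  split_ifs <;> simp

theorem IsDistF.integrable_signedGap {G : ℝ → ℝ} (hG : IsDistF G)
    (hGint : Integrable (tilt G) volume) :
    Integrable (fun p : ℝ × ℝ => signedGap (G p.2) p.1 p.2)
      ((volume.restrict (Ioo (0 : ℝ) 1)).prod volume) := by
  have hm := measurable_signedGap hG.1.measurable
  rw [integrable_prod_iff' hm.aestronglyMeasurable]
  refine ⟨Eventually.of_forall fun x => ?_, ?_⟩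
  · refine Integrable.of_bound (C := 1) ?_ (Eventually.of_forall fun s => ?_)
    · exact (hm.comp measurable_prodMk_right).aestronglyMeasurable
    · exact abs_signedGap_le_one _ _ _
  · refine hGint.abs.congr (Eventually.of_forall fun x => ?_)
    simp only [Real.norm_eq_abs, setIntegral_abs_signedGap (hG.mem_Icc x), tilt]
    obtain ⟨h0, h1⟩ := hG.mem_Icc x
    split_ifs
    · exact abs_of_nonneg h0
    · rw [abs_of_nonpos (by linarith)]
      ring

/-- The L-functional as an integral over the line, for a bounded continuous score function. -/
theorem IsDistF.integrable_and_LFun_tilt_eq {φ : ℝ → ℝ} (hφ : Continuous φ) {M : ℝ}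
    (hM : ∀ s, |φ s| ≤ M) {G : ℝ → ℝ} (hG : IsDistF G) (hGint : Integrable (tilt G) volume) :
    Integrable (fun x => if x < 0 then -∫ s in (0 : ℝ)..G x, φ s else ∫ s in (G x)..1, φ s) ∧
      LFun φ (tilt G) =
        ∫ x, if x < 0 then -∫ s in (0 : ℝ)..G x, φ s else ∫ s in (G x)..1, φ s := by
  have hint : Integrable (fun p : ℝ × ℝ => φ p.1 * signedGap (G p.2) p.1 p.2)
      ((volume.restrict (Ioo (0 : ℝ) 1)).prod volume) :=
    (hG.integrable_signedGap hGint).bdd_mul (hφ.comp continuous_fst).aestronglyMeasurable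
      (Eventually.of_forall fun p => hM p.1)
  have hinner (x : ℝ) := setIntegral_mul_signedGap φ (hG.mem_Icc x) x
  simp only [← hinner]
  refine ⟨hint.integral_prod_right, ?_⟩
  rw [LFun, untilt_tilt, ← integral_integral_swap hint]
  refine setIntegral_congr_fun measurableSet_Ioo fun s hs => ?_
  simp only [integral_const_mul, hG.integral_signedGap hs]
  ring

theorem LFun_tilt_sub {φ : ℝ → ℝ} (hφ : Continuous φ) {M : ℝ} (hM : ∀ s, |φ s| ≤ M)
    {F G : ℝ → ℝ} (hF : IsDistF F) (hFint : Integrable (tilt F) volume)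
    (hG : IsDistF G) (hGint : Integrable (tilt G) volume) :
    LFun φ (tilt G) - LFun φ (tilt F) = -∫ x, ∫ s in (F x)..G x, φ s := by
  obtain ⟨iG, eG⟩ := hG.integrable_and_LFun_tilt_eq hφ hM hGint
  obtain ⟨iF, eF⟩ := hF.integrable_and_LFun_tilt_eq hφ hM hFint
  rw [eG, eF, ← integral_sub iG iF, ← integral_neg]
  congr 1 with x
  have hi (a b : ℝ) : IntervalIntegrable φ volume a b := hφ.intervalIntegrable a b
  split_ifs
  · rw [← intervalIntegral.integral_interval_sub_left (hi 0 (G x)) (hi 0 (F x))]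
    ring
  · rw [← intervalIntegral.integral_add_adjacent_intervals (hi (F x) (G x)) (hi (G x) 1)]
    ring

theorem LFun_congr_score {J φ : ℝ → ℝ} (h : EqOn J φ (Ioo 0 1)) (f : ℝ → ℝ) :
    LFun J f = LFun φ f :=
  setIntegral_congr_fun measurableSet_Ioo fun s hs => by simp only [h hs]

/-- The primitive of a bounded continuous function has an `L¹`-Hadamard derivative as a
superposition operator. -/
theorem tendsto_integral_intervalIntegral_difference_quotient {φ : ℝ → ℝ} (hφ : Continuous φ)
    {M : ℝ} (hM : ∀ s, |φ s| ≤ M) {F α : ℝ → ℝ} (hF : Measurable F) (hα : Integrable α)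
    {t : ℕ → ℝ} (ht_pos : ∀ n, 0 < t n) (ht : Tendsto t atTop (𝓝 0)) {H : ℕ → ℝ → ℝ}
    (hHint : ∀ n, Integrable (fun x => H n x - α x))
    (hHL1 : Tendsto (fun n => ∫ x, |H n x - α x|) atTop (𝓝 0)) :
    Tendsto (fun n => ∫ x, (t n)⁻¹ * ∫ s in (F x)..(F x + t n * H n x), φ s) atTop
      (𝓝 (∫ x, α x * φ (F x))) := by
  have hi (a b : ℝ) : IntervalIntegrable φ volume a b := hφ.intervalIntegrable a b
  have hM0 : 0 ≤ M := (abs_nonneg _).trans (hM 0)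
  have hbound (a b : ℝ) : |∫ s in a..b, φ s| ≤ M * |b - a| := by
    rw [← Real.norm_eq_abs]
    exact intervalIntegral.norm_integral_le_of_norm_le_const fun s _ => hM s
  have hprim : Continuous fun u => ∫ s in (0 : ℝ)..u, φ s :=
    intervalIntegral.continuous_primitive hi 0
  have hmeas {a b : ℝ → ℝ} (ha : AEStronglyMeasurable a) (hb : AEStronglyMeasurable b) :
      AEStronglyMeasurable fun x => ∫ s in (a x)..(b x), φ s := by
    refine ((hprim.comp_aestronglyMeasurable hb).sub
      (hprim.comp_aestronglyMeasurable ha)).congr (Eventually.of_forall fun x => ?_)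
    exact intervalIntegral.integral_interval_sub_left (hi _ _) (hi _ _)
  have hFm : AEStronglyMeasurable F := hF.aestronglyMeasurable
  have hmα (n : ℕ) : AEStronglyMeasurable fun x => F x + t n * α x :=
    hFm.add (hα.aestronglyMeasurable.const_mul _)
  have hmH (n : ℕ) : AEStronglyMeasurable fun x => F x + t n * H n x := by
    refine hFm.add (AEStronglyMeasurable.const_mul ?_ _)
    simpa [Pi.add_def] using ((hHint n).add hα).aestronglyMeasurable
  have hmain_le (n : ℕ) (x : ℝ) :
      ‖(t n)⁻¹ * ∫ s in (F x)..(F x + t n * α x), φ s‖ ≤ M * |α x| := by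
    have h := hbound (F x) (F x + t n * α x)
    rw [add_sub_cancel_left, abs_mul, abs_of_pos (ht_pos n)] at h
    rw [Real.norm_eq_abs, abs_mul, abs_of_pos (inv_pos.2 (ht_pos n)),
      inv_mul_le_iff₀ (ht_pos n)]
    linarith
  have herr_le (n : ℕ) (x : ℝ) :
      ‖(t n)⁻¹ * ∫ s in (F x + t n * α x)..(F x + t n * H n x), φ s‖ ≤ M * |H n x - α x| := by
    have h := hbound (F x + t n * α x) (F x + t n * H n x)
    rw [add_sub_add_left_eq_sub, ← mul_sub, abs_mul, abs_of_pos (ht_pos n)] at h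
    rw [Real.norm_eq_abs, abs_mul, abs_of_pos (inv_pos.2 (ht_pos n)),
      inv_mul_le_iff₀ (ht_pos n)]
    linarith
  have hmain_int (n : ℕ) :
      Integrable fun x => (t n)⁻¹ * ∫ s in (F x)..(F x + t n * α x), φ s :=
    (hα.abs.const_mul M).mono' ((hmeas hFm (hmα n)).const_mul _)
      (Eventually.of_forall (hmain_le n))
  have herr_int (n : ℕ) :
      Integrable fun x => (t n)⁻¹ * ∫ s in (F x + t n * α x)..(F x + t n * H n x), φ s :=
    ((hHint n).abs.const_mul M).mono' ((hmeas (hmα n) (hmH n)).const_mul _)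
      (Eventually.of_forall (herr_le n))
  have hmain : Tendsto (fun n => ∫ x, (t n)⁻¹ * ∫ s in (F x)..(F x + t n * α x), φ s) atTop
      (𝓝 (∫ x, α x * φ (F x))) := by
    refine tendsto_integral_of_dominated_convergence (fun x => M * |α x|)
      (fun n => (hmain_int n).aestronglyMeasurable) (hα.abs.const_mul M)
      (fun n => Eventually.of_forall (hmain_le n)) (Eventually.of_forall fun x => ?_)
    have hd : HasDerivAt (fun r : ℝ => ∫ s in (F x)..(F x + r * α x), φ s)
        (φ (F x) * α x) 0 := by
      have h1 : HasDerivAt (fun u => ∫ s in (F x)..u, φ s) (φ (F x))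
          (F x + 0 * α x) := by
        simpa using (hφ.integral_hasStrictDerivAt (F x) (F x)).hasDerivAt
      have h2 : HasDerivAt (fun r : ℝ => F x + r * α x) (α x) 0 := by
        simpa using ((hasDerivAt_id (0 : ℝ)).mul_const (α x)).const_add (F x)
      exact h1.comp (0 : ℝ) h2
    have hslope := hd.tendsto_slope_zero
    have ht' : Tendsto t atTop (𝓝[≠] 0) :=
      tendsto_nhdsWithin_iff.2 ⟨ht, Eventually.of_forall fun n => (ht_pos n).ne'⟩
    simpa [Function.comp_def, mul_comm (φ (F x))] using hslope.comp ht'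
  have herr : Tendsto (fun n => ∫ x, (t n)⁻¹ *
      ∫ s in (F x + t n * α x)..(F x + t n * H n x), φ s) atTop (𝓝 0) := by
    refine squeeze_zero_norm (a := fun n => M * ∫ x, |H n x - α x|) (fun n => ?_) ?_
    · rw [← integral_const_mul]
      exact norm_integral_le_of_norm_le ((hHint n).abs.const_mul M)
        (Eventually.of_forall (herr_le n))
    · simpa using hHL1.const_mul M
  have hsum := hmain.add herr
  rw [add_zero] at hsum
  refine hsum.congr fun n => ?_
  rw [← integral_add (hmain_int n) (herr_int n)]
  congr 1 with x
  rw [← mul_add, intervalIntegral.integral_add_adjacent_intervals (hi _ _) (hi _ _)]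

/-- **Hadamard differentiability of the L-functional in `L¹(ℝ)`** (tangentially to
`D̃₀ = {a (G̃ - F̃)}`, with respect to `L¹`-convergence), for a Lipschitz score function `J`. -/
theorem LFun_hadamard_differentiable
    (J : ℝ → ℝ) (K : NNReal) (hJ : LipschitzOnWith K J (Set.Icc 0 1))
    (F : ℝ → ℝ) (hF : IsDistF F) (hFint : Integrable (tilt F) volume)
    -- a direction α = a (G̃ - F̃) in D̃₀
    (α : ℝ → ℝ)
    (hα : ∃ (c : ℝ) (G : ℝ → ℝ), IsDistF G ∧ Integrable (tilt G) volume ∧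
      ∀ x, α x = c * (tilt G x - tilt F x))
    -- sequences tₙ → 0⁺ and Hₙ → α in L¹ with F̃ + tₙ Hₙ ∈ D̃_Φ
    (t : ℕ → ℝ) (ht_pos : ∀ n, 0 < t n) (ht : Tendsto t atTop (𝓝 0))
    (H : ℕ → ℝ → ℝ)
    (hHint : ∀ n, Integrable (fun x => H n x - α x) volume)
    (hHL1 : Tendsto (fun n => ∫ x, |H n x - α x|) atTop (𝓝 0))
    (hHdom : ∀ n, ∃ G : ℝ → ℝ, IsDistF G ∧ Integrable (tilt G) volume ∧
      ∀ x, tilt F x + t n * H n x = tilt G x) :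
    Tendsto (fun n => (t n)⁻¹ * (LFun J (fun x => tilt F x + t n * H n x) - LFun J (tilt F)))
      atTop (𝓝 (-(∫ x, α x * J (F x)))) := by
  obtain ⟨c, G₀, -, hG₀int, hαeq⟩ := hα
  have hαint : Integrable α volume := by
    rw [show α = fun x => c * (tilt G₀ x - tilt F x) from funext hαeq]
    exact (hG₀int.sub hFint).const_mul c
  set φ : ℝ → ℝ := IccExtend zero_le_one ((Icc (0 : ℝ) 1).domRestrict J) with hφdef
  have hφ : Continuous φ := hJ.continuousOn.domRestrict.Icc_extend'
  have hφJ : EqOn J φ (Icc 0 1) := fun s hs => by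
    rw [hφdef, IccExtend_of_mem _ _ hs, domRestrict_apply]
  obtain ⟨M, hM'⟩ := isCompact_Icc.exists_bound_of_continuousOn hJ.continuousOn
  have hM : ∀ s, |φ s| ≤ M := fun s => hM' _ (projIcc (0 : ℝ) 1 zero_le_one s).2
  choose G hG hGint hGeq using hHdom
  have hGF (n : ℕ) (x : ℝ) : G n x = F x + t n * H n x := by
    have h := hGeq n x
    simp only [tilt] at h
    split_ifs at h <;> linarith
  simp only [LFun_congr_score (hφJ.mono Ioo_subset_Icc_self), hφJ (hF.mem_Icc _)]
  refine (tendsto_integral_intervalIntegral_difference_quotient hφ hM hF.1.measurable hαint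
    ht_pos ht hHint hHL1).neg.congr fun n => ?_
  rw [funext (hGeq n), LFun_tilt_sub hφ hM hF hFint (hG n) (hGint n), integral_const_mul, mul_neg]
  simp only [hGF]
end
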